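/- arXiv:1201.3467 — 3 statements merged into one kernel-verified Lean document; each statement's English description precedes it below -/
import Mathlib

section
/- A real n×n matrix A is a P-matrix if and only if the matrix I − D + DA is nonsingular for every diagonal matrix D = diag(d₁,…,dₙ) with 0 ≤ d_i ≤ 1 for all i = 1,…,n. -/
/-- `A` is a P-matrix: every principal minor is positive. -/
def IsPMatrix {n : ℕ} (A : Matrix (Fin n) (Fin n) ℝ) : Prop :=
  ∀ J : Finset (Fin n), J.Nonempty →
    0 < (A.submatrix (fun j : J => (j : Fin n)) (fun j : J => (j : Fin n))).det

/-- The determinant of a row-wise convex combination of the identity and `A`, expanded over the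
principal minors of `A`. -/
theorem det_one_sub_diagonal_add_diagonal_mul {ι R : Type*} [Fintype ι] [DecidableEq ι]
    [CommRing R] (A : Matrix ι ι R) (d : ι → R) :
    (1 - Matrix.diagonal d + Matrix.diagonal d * A).det =
      ∑ s : Finset ι, (∏ i, if i ∈ s then d i else 1 - d i) *
        (A.submatrix (Subtype.val : s → ι) (Subtype.val : s → ι)).det := by
  have hrows : (1 - Matrix.diagonal d + Matrix.diagonal d * A) =
      (fun i => d i • A i) + fun i => (1 - d i) • (1 : Matrix ι ι R) i := by
    ext i j
    simp only [Matrix.add_apply, Matrix.sub_apply, Matrix.diagonal_mul, Pi.add_apply,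
      Pi.smul_apply, smul_eq_mul, Matrix.diagonal_apply, Matrix.one_apply]
    split_ifs <;> ring
  rw [hrows]
  refine (Matrix.detRowAlternating.map_add_univ _ _).trans (Finset.sum_congr rfl fun s _ => ?_)
  have hsmul : s.piecewise (fun i => d i • A i) (fun i => (1 - d i) • (1 : Matrix ι ι R) i) =
      fun i => (if i ∈ s then d i else 1 - d i) • s.piecewise A.row (1 : Matrix ι ι R).row i := by
    funext i
    by_cases h : i ∈ s <;> simp [h, Finset.piecewise, Matrix.row]
  rw [hsmul, AlternatingMap.map_smul_univ, smul_eq_mul,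
    ← Matrix.det_piecewise_one_eq_submatrix_det]
  rfl

/-- A principal minor of `A` is `det (I - D + D A)` for `D` the indicator of its index set. -/
theorem det_one_sub_diagonal_indicator {ι R : Type*} [Fintype ι] [DecidableEq ι]
    [CommRing R] (A : Matrix ι ι R) (J : Finset ι) :
    (1 - Matrix.diagonal (fun i => if i ∈ J then 1 else 0) +
      Matrix.diagonal (fun i => if i ∈ J then 1 else 0) * A).det =
      (A.submatrix (Subtype.val : J → ι) (Subtype.val : J → ι)).det := by
  rw [← Matrix.det_piecewise_one_eq_submatrix_det]
  congr 1
  ext i j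
  by_cases h : i ∈ J <;>
    simp [h, Matrix.diagonal_apply, Matrix.one_apply, Matrix.diagonal_mul]

/-- `A` is a P-matrix if and only if `I − D + D A` is nonsingular for every diagonal
matrix `D = diag(d)` with `0 ≤ dᵢ ≤ 1` for all `i`. -/
theorem stmt_8 {n : ℕ} (A : Matrix (Fin n) (Fin n) ℝ) :
    IsPMatrix A ↔
      ∀ d : Fin n → ℝ, (∀ i, d i ∈ Set.Icc (0 : ℝ) 1) →
        (1 - Matrix.diagonal d + Matrix.diagonal d * A).det ≠ 0 := by
  constructor
  · intro hA d hd
    have hminor (s : Finset (Fin n)) :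
        0 < (A.submatrix (Subtype.val : s → Fin n) (Subtype.val : s → Fin n)).det := by
      obtain rfl | hs := s.eq_empty_or_nonempty
      · simp
      · exact hA s hs
    rw [det_one_sub_diagonal_add_diagonal_mul]
    refine (Finset.sum_pos' (fun s _ => mul_nonneg (Finset.prod_nonneg fun i _ => ?_)
      (hminor s).le) ⟨Finset.univ.filter (fun i => 0 < d i), Finset.mem_univ _,
        mul_pos (Finset.prod_pos fun i _ => ?_) (hminor _)⟩).ne'
    · split_ifs
      · exact (hd i).1
      · exact sub_nonneg.2 (hd i).2
    · simp only [Finset.mem_filter, Finset.mem_univ, true_and]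
      split_ifs <;> linarith
  · intro h J _
    let e : Fin n → ℝ := fun i => if i ∈ J then 1 else 0
    let f : ℝ → ℝ := fun t => (1 - Matrix.diagonal (t • e) + Matrix.diagonal (t • e) * A).det
    have hf : Continuous f := by fun_prop
    have hne (t : ℝ) (ht : t ∈ Set.Icc (0 : ℝ) 1) : f t ≠ 0 := by
      refine h _ fun i => ?_
      by_cases hi : i ∈ J <;> simp [e, hi, ht.1, ht.2]
    have hf0 : f 0 = 1 := by simp [f]
    have hf1 : f 1 = (A.submatrix (Subtype.val : J → Fin n) (Subtype.val : J → Fin n)).det := by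
      simp only [f, one_smul]
      exact det_one_sub_diagonal_indicator A J
    change 0 < (A.submatrix (Subtype.val : J → Fin n) (Subtype.val : J → Fin n)).det
    rw [← hf1]
    by_contra! hneg
    obtain ⟨t, ht, hft⟩ := intermediate_value_Icc' zero_le_one hf.continuousOn
      ⟨hneg, hf0 ▸ zero_le_one⟩
    exact hne t ht hft
end

section
/- Let A be a real n×n P-matrix and define β(A) = max over diagonal matrices D = diag(d) with d ∈ [0,1]ⁿ of ‖(I − D + DA)⁻¹ D‖. Let B be a real n×n matrix and p, q ∈ ℝⁿ, and suppose x solves LCP(A, q) and y solves LCP(B, p). Then ‖y − x‖ ≤ β(A) · ‖(A − B)y + q − p‖. -/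
open scoped RealInnerProductSpace

/-- `β(A) = max_{d ∈ [0,1]ⁿ} ‖(I − D + D A)⁻¹ D‖`, where `D = diag(d)` and `‖·‖` is the
operator norm induced by the Euclidean norm. -/
noncomputable def betaP {n : ℕ} (A : Matrix (Fin n) (Fin n) ℝ) : ℝ :=
  sSup ((fun d : Fin n → ℝ =>
      ‖Matrix.toEuclideanCLM (𝕜 := ℝ)
        ((1 - Matrix.diagonal d + Matrix.diagonal d * A)⁻¹ * Matrix.diagonal d)‖) ''
    {d : Fin n → ℝ | ∀ i, d i ∈ Set.Icc (0 : ℝ) 1})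

/-- `x` solves the linear complementarity problem `LCP(M, q)`. -/
def IsLCPSol {n : ℕ} (M : Matrix (Fin n) (Fin n) ℝ) (q x : EuclideanSpace ℝ (Fin n)) : Prop :=
  (∀ i, 0 ≤ x i) ∧ (∀ i, 0 ≤ (Matrix.toEuclideanCLM (𝕜 := ℝ) M x + q) i) ∧
    ⟪x, Matrix.toEuclideanCLM (𝕜 := ℝ) M x + q⟫ = 0

namespace IsPMatrix

variable {n : ℕ} {A : Matrix (Fin n) (Fin n) ℝ}

theorem det_submatrix_pos (hA : IsPMatrix A) (J : Finset (Fin n)) :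
    0 < (A.submatrix (fun j : J => (j : Fin n)) (fun j : J => (j : Fin n))).det := by
  rcases J.eq_empty_or_nonempty with rfl | h
  · simp
  · exact hA J h

/-- At a vertex of the cube the matrix `I − D + D A` has a principal minor of `A` as its
determinant. -/
theorem det_pos_of_zero_or_one (hA : IsPMatrix A) {d : Fin n → ℝ} (hd : ∀ i, d i = 0 ∨ d i = 1) :
    0 < (1 - Matrix.diagonal d + Matrix.diagonal d * A).det := by
  classical
  rw [Matrix.twoBlockTriangular_det _ (fun i => i ∈ Finset.univ.filter fun i => d i = 1)]
  · have hcompl : Matrix.toSquareBlockProp (1 - Matrix.diagonal d + Matrix.diagonal d * A)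
        (fun i => ¬ i ∈ Finset.univ.filter fun i => d i = 1) = 1 := by
      ext i j
      have hi : d i = 0 := (hd i).resolve_right (by simpa using i.2)
      simp [Matrix.toSquareBlockProp_def, Matrix.diagonal_mul, Matrix.diagonal_apply,
        Matrix.one_apply, hi, Subtype.ext_iff]
    have hmain : Matrix.toSquareBlockProp (1 - Matrix.diagonal d + Matrix.diagonal d * A)
        (fun i => i ∈ Finset.univ.filter fun i => d i = 1) =
        A.submatrix (fun j : (Finset.univ.filter fun i => d i = 1 : Finset (Fin n)) => (j : Fin n))
          (fun j : (Finset.univ.filter fun i => d i = 1 : Finset (Fin n)) => (j : Fin n)) := by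
      ext i j
      have hi : d i = 1 := (Finset.mem_filter.1 i.2).2
      simp [Matrix.toSquareBlockProp_def, Matrix.diagonal_mul, Matrix.diagonal_apply,
        Matrix.one_apply, hi]
    rw [hcompl, hmain, Matrix.det_one, mul_one]
    convert hA.det_submatrix_pos (Finset.univ.filter fun i => d i = 1)
  · intro i hi j hj
    have hi : d i = 0 := (hd i).resolve_right (by simpa using hi)
    have hj : d j = 1 := by simpa using hj
    have hij : i ≠ j := by
      rintro rfl
      simp [hi] at hj
    simp [Matrix.diagonal_mul, hij, hi]

/-- The determinant of `I − D + D A` is affine in each diagonal entry of `D`. -/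
theorem _root_.Matrix.det_one_sub_diagonal_add_eq (A : Matrix (Fin n) (Fin n) ℝ) (d : Fin n → ℝ)
    (i : Fin n) :
    (1 - Matrix.diagonal d + Matrix.diagonal d * A).det =
      (1 - d i) * (1 - Matrix.diagonal (Function.update d i 0) +
        Matrix.diagonal (Function.update d i 0) * A).det +
      d i * (1 - Matrix.diagonal (Function.update d i 1) +
        Matrix.diagonal (Function.update d i 1) * A).det := by
  have hrow (t : ℝ) : 1 - Matrix.diagonal (Function.update d i t) +
      Matrix.diagonal (Function.update d i t) * A =
      (1 - Matrix.diagonal d + Matrix.diagonal d * A).updateRow i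
        ((1 - t) • (1 : Matrix (Fin n) (Fin n) ℝ) i + t • A i) := by
    ext k j
    rcases eq_or_ne k i with rfl | hk
    · rcases eq_or_ne k j with rfl | hj
      · simp [Matrix.diagonal_mul]
      · simp [Matrix.diagonal_mul, hj]
    · rcases eq_or_ne k j with rfl | hj
      · simp [Matrix.diagonal_mul, hk]
      · simp [Matrix.diagonal_mul, hk, hj]
  have h := hrow (d i)
  rw [Function.update_eq_self] at h
  rw [hrow 0, hrow 1]
  conv_lhs => rw [h]
  simp [Matrix.det_updateRow_add, Matrix.det_updateRow_smul]

theorem det_pos (hA : IsPMatrix A) {d : Fin n → ℝ} (hd : ∀ i, d i ∈ Set.Icc (0 : ℝ) 1) :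
    0 < (1 - Matrix.diagonal d + Matrix.diagonal d * A).det := by
  suffices H : ∀ (s : Finset (Fin n)) (d : Fin n → ℝ), (∀ i, d i ∈ Set.Icc (0 : ℝ) 1) →
      (∀ i ∉ s, d i = 0 ∨ d i = 1) →
      0 < (1 - Matrix.diagonal d + Matrix.diagonal d * A).det from
    H Finset.univ d hd (by simp)
  intro s
  induction s using Finset.induction_on with
  | empty => exact fun d _ h => hA.det_pos_of_zero_or_one fun i => h i (by simp)
  | insert a s _ ih =>
    intro d hd h
    have hvertex (t : ℝ) (ht : t = 0 ∨ t = 1) :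
        0 < (1 - Matrix.diagonal (Function.update d a t) +
          Matrix.diagonal (Function.update d a t) * A).det := by
      refine ih _ (fun i => ?_) (fun i hi => ?_)
      · rcases eq_or_ne i a with rfl | hia
        · rcases ht with rfl | rfl <;> simp
        · simpa [hia] using hd i
      · rcases eq_or_ne i a with rfl | hia
        · simpa using ht
        · simpa [hia] using h i (by simp [hia, hi])
    rw [Matrix.det_one_sub_diagonal_add_eq A d a]
    have h0 := hvertex 0 (.inl rfl)
    have h1 := hvertex 1 (.inr rfl)
    obtain ⟨hd0, hd1⟩ := hd a
    rcases hd0.eq_or_lt with h | h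
    · simpa [← h] using h0
    · exact add_pos_of_nonneg_of_pos (mul_nonneg (sub_nonneg.2 hd1) h0.le) (mul_pos h h1)

theorem norm_le_betaP (hA : IsPMatrix A) {d : Fin n → ℝ} (hd : ∀ i, d i ∈ Set.Icc (0 : ℝ) 1) :
    ‖Matrix.toEuclideanCLM (𝕜 := ℝ)
      ((1 - Matrix.diagonal d + Matrix.diagonal d * A)⁻¹ * Matrix.diagonal d)‖ ≤ betaP A := by
  refine le_csSup (IsCompact.bddAbove_image ?_ ?_) ⟨d, hd, rfl⟩
  · have h : {d : Fin n → ℝ | ∀ i, d i ∈ Set.Icc (0 : ℝ) 1} =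
        Set.univ.pi fun _ => Set.Icc (0 : ℝ) 1 := by
      ext
      simp only [Set.mem_ofPred_eq, Set.mem_univ_pi]
    rw [h]
    exact isCompact_univ_pi fun _ => isCompact_Icc
  · have hlin : Continuous (Matrix.toEuclideanCLM (n := Fin n) (𝕜 := ℝ)) :=
      (Matrix.toEuclideanCLM (n := Fin n) (𝕜 := ℝ)).toAlgEquiv.toLinearMap
        |>.continuous_of_finiteDimensional
    have hM : Continuous fun d : Fin n → ℝ =>
        1 - Matrix.diagonal d + Matrix.diagonal d * A := by fun_prop
    refine (hlin.comp_continuousOn (ContinuousOn.mul ?_ (by fun_prop))).norm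
    simp_rw [Matrix.inv_def, Ring.inverse_eq_inv']
    exact (hM.matrix_det.continuousOn.inv₀ fun d hd => (hA.det_pos hd).ne').smul
      hM.matrix_adjugate.continuousOn

end IsPMatrix

theorem IsLCPSol.mul_eq_zero {n : ℕ} {M : Matrix (Fin n) (Fin n) ℝ}
    {q x : EuclideanSpace ℝ (Fin n)} (h : IsLCPSol M q x) (i : Fin n) :
    x i * (Matrix.toEuclideanCLM (𝕜 := ℝ) M x + q) i = 0 := by
  obtain ⟨hx, hw, hin⟩ := h
  rw [PiLp.inner_apply, Finset.sum_eq_zero_iff_of_nonneg] at hin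
  · simpa [mul_comm] using hin i (Finset.mem_univ i)
  · intro j _
    simpa [mul_comm] using mul_nonneg (hx j) (hw j)

theorem exists_convex_combination_eq_zero {a b : ℝ} (h : a * b ≤ 0) :
    ∃ t ∈ Set.Icc (0 : ℝ) 1, (1 - t) * a + t * b = 0 := by
  rcases mul_nonpos_iff.1 h with ⟨ha, hb⟩ | ⟨ha, hb⟩
  · have : (0 : ℝ) ∈ segment ℝ a b := by
      rw [segment_symm, segment_eq_Icc (hb.trans ha)]
      exact ⟨hb, ha⟩
    rw [segment_eq_image] at this
    simpa using this
  · have : (0 : ℝ) ∈ segment ℝ a b := by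
      rw [segment_eq_Icc (ha.trans hb)]
      exact ⟨ha, hb⟩
    rw [segment_eq_image] at this
    simpa using this

/-- If `A` is a P-matrix, `x` solves `LCP(A, q)` and `y` solves `LCP(B, p)`, then
`‖y − x‖ ≤ β(A) · ‖(A − B) y + q − p‖`. -/
theorem stmt_9 {n : ℕ} (A B : Matrix (Fin n) (Fin n) ℝ)
    (q p x y : EuclideanSpace ℝ (Fin n))
    (hA : IsPMatrix A) (hx : IsLCPSol A q x) (hy : IsLCPSol B p y) :
    ‖y - x‖ ≤ betaP A * ‖Matrix.toEuclideanCLM (𝕜 := ℝ) (A - B) y + q - p‖ := by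
  set u := Matrix.toEuclideanCLM (𝕜 := ℝ) A x + q with hu
  set v := Matrix.toEuclideanCLM (𝕜 := ℝ) B y + p with hv
  have hsign (i : Fin n) : (y i - x i) * (v i - u i) ≤ 0 := by
    have hxu := hx.mul_eq_zero i
    have hyv := hy.mul_eq_zero i
    have hyu := mul_nonneg (hy.1 i) (hx.2.1 i)
    have hxv := mul_nonneg (hx.1 i) (hy.2.1 i)
    rw [← hu] at hxu hyu
    rw [← hv] at hyv hxv
    linarith [sub_mul (y i) (x i) (v i - u i), mul_sub (y i) (v i) (u i),
      mul_sub (x i) (v i) (u i)]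
  choose d hd hcomb using fun i => exists_convex_combination_eq_zero (hsign i)
  set M := 1 - Matrix.diagonal d + Matrix.diagonal d * A with hM
  have hunit : IsUnit M.det := (hA.det_pos hd).ne'.isUnit
  have hr : Matrix.toEuclideanCLM (𝕜 := ℝ) (A - B) y + q - p =
      Matrix.toEuclideanCLM (𝕜 := ℝ) A (y - x) - (v - u) := by
    simp only [hu, hv, map_sub, sub_apply]
    abel
  have hMyx : Matrix.toEuclideanCLM (𝕜 := ℝ) M (y - x) =
      Matrix.toEuclideanCLM (𝕜 := ℝ) (Matrix.diagonal d)
        (Matrix.toEuclideanCLM (𝕜 := ℝ) (A - B) y + q - p) := by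
    rw [hr]
    simp only [hM, map_sub, map_add, map_mul, map_one, sub_apply,
      add_apply, mul_apply_eq_comp,
      one_apply_eq_self]
    ext i
    have := hcomb i
    simp [Matrix.ofLp_toEuclideanCLM, Matrix.mulVec_diagonal]
    linarith
  have hyx : y - x = Matrix.toEuclideanCLM (𝕜 := ℝ) (M⁻¹ * Matrix.diagonal d)
      (Matrix.toEuclideanCLM (𝕜 := ℝ) (A - B) y + q - p) := by
    rw [map_mul, mul_apply_eq_comp, ← hMyx, ← mul_apply_eq_comp,
      ← map_mul, Matrix.nonsing_inv_mul _ hunit, map_one, one_apply_eq_self]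
  calc ‖y - x‖ = ‖Matrix.toEuclideanCLM (𝕜 := ℝ) (M⁻¹ * Matrix.diagonal d)
        (Matrix.toEuclideanCLM (𝕜 := ℝ) (A - B) y + q - p)‖ := congrArg _ hyx
    _ ≤ _ := (ContinuousLinearMap.le_opNorm _ _).trans
      (mul_le_mul_of_nonneg_right (hA.norm_le_betaP hd) (norm_nonneg _))
end

section
/- Let M be a real n×n P-matrix with β(M) = max over diagonal matrices D = diag(d), d ∈ [0,1]ⁿ, of ‖(I − D + DM)⁻¹ D‖, and let ΔM be a real n×n matrix and η a constant with β(M)·‖ΔM‖ ≤ η < 1. Then M + ΔM is a P-matrix and β(M + ΔM) ≤ β(M) / (1 − η). -/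
/-- The matrix with rows of `A` on `s` and of the identity off `s` has the principal minor of `A`
on `s` as its determinant. -/
theorem det_piecewise_one {ι R : Type*} [Fintype ι] [DecidableEq ι] [CommRing R]
    (A : Matrix ι ι R) (s : Finset ι) :
    (Matrix.of (s.piecewise A.row (1 : Matrix ι ι R).row)).det =
      (A.submatrix (fun j : s => (j : ι)) (fun j : s => (j : ι))).det := by
  rw [Matrix.twoBlockTriangular_det _ (fun i => i ∈ s)]
  · have h : (Matrix.of (s.piecewise A.row (1 : Matrix ι ι R).row)).toSquareBlockProp
        (fun i => ¬ i ∈ s) = 1 := by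
      ext ⟨i, hi⟩ ⟨j, hj⟩
      simp [Matrix.toSquareBlockProp, Matrix.one_apply, Finset.piecewise, hi, Matrix.row]
    rw [h, Matrix.det_one, mul_one]
    have h' : (Matrix.of (s.piecewise A.row (1 : Matrix ι ι R).row)).toSquareBlockProp
        (fun i => i ∈ s) = A.submatrix (fun j : s => (j : ι)) (fun j : s => (j : ι)) := by
      ext ⟨i, hi⟩ ⟨j, hj⟩
      simp [Matrix.toSquareBlockProp, Finset.piecewise, hi, Matrix.row]
    rw [h']
    congr!
  · intro i hi j hj
    have hij : i ≠ j := fun h => hi (h ▸ hj)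
    simp [Finset.piecewise, hi, Matrix.row, hij]

/-- Expansion of `det (I - D + D A)` into principal minors of `A`. -/
theorem det_one_sub_diagonal_add {ι R : Type*} [Fintype ι] [DecidableEq ι] [CommRing R]
    (A : Matrix ι ι R) (d : ι → R) :
    (1 - Matrix.diagonal d + Matrix.diagonal d * A).det =
      ∑ s : Finset ι, (∏ i, if i ∈ s then d i else 1 - d i) *
        (A.submatrix (fun j : s => (j : ι)) (fun j : s => (j : ι))).det := by
  have h : 1 - Matrix.diagonal d + Matrix.diagonal d * A =
      Matrix.of ((fun i => d i • A.row i) + fun i => (1 - d i) • (1 : Matrix ι ι R).row i) := by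
    ext i j
    rcases eq_or_ne i j with rfl | hij
    · simp [Matrix.row]; ring
    · simp [Matrix.row, hij]
  rw [h]
  change Matrix.detRowAlternating.toMultilinearMap _ = _
  rw [show (Matrix.of ((fun i => d i • A.row i) +
      fun i => (1 - d i) • (1 : Matrix ι ι R).row i) : Matrix ι ι R) =
      ((fun i => d i • A.row i) + fun i => (1 - d i) • (1 : Matrix ι ι R).row i : ι → ι → R)
      from rfl, MultilinearMap.map_add_univ]
  refine Finset.sum_congr rfl fun s _ => ?_
  have hs : s.piecewise (fun i => d i • A.row i) (fun i => (1 - d i) • (1 : Matrix ι ι R).row i) =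
      fun i => (if i ∈ s then d i else 1 - d i) • s.piecewise A.row (1 : Matrix ι ι R).row i := by
    funext i
    by_cases hi : i ∈ s <;> simp [hi]
  rw [hs, MultilinearMap.map_smul_univ, smul_eq_mul, ← det_piecewise_one]
  rfl

/-- If `A` is a P-matrix, then `det (I - D + D A) > 0` for every `D = diag(d)`, `d ∈ [0,1]ⁿ`. -/
theorem IsPMatrix.det_pos_s11 {n : ℕ} {A : Matrix (Fin n) (Fin n) ℝ} (hA : IsPMatrix A)
    {d : Fin n → ℝ} (hd : ∀ i, d i ∈ Set.Icc (0 : ℝ) 1) :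
    0 < (1 - Matrix.diagonal d + Matrix.diagonal d * A).det := by
  rw [det_one_sub_diagonal_add]
  have hminor : ∀ s : Finset (Fin n),
      0 < (A.submatrix (fun j : s => (j : Fin n)) (fun j : s => (j : Fin n))).det := by
    intro s
    rcases s.eq_empty_or_nonempty with rfl | hs
    · simp
    · exact hA s hs
  refine Finset.sum_pos' (fun s _ => mul_nonneg (Finset.prod_nonneg fun i _ => ?_) (hminor s).le)
    ⟨Finset.univ.filter fun i => 0 < d i, Finset.mem_univ _,
      mul_pos (Finset.prod_pos fun i _ => ?_) (hminor _)⟩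
  · have := hd i
    split_ifs
    · exact this.1
    · linarith [this.2]
  · by_cases hi : 0 < d i
    · simp [hi]
    · have := (hd i).1
      simp only [Finset.mem_filter, Finset.mem_univ, true_and, hi, if_false]
      linarith

/-- If `I - D + D A` is nonsingular for every `D = diag(d)`, `d ∈ [0,1]ⁿ`, then `A` is a
P-matrix. -/
theorem isPMatrix_of_det_ne_zero {n : ℕ} {A : Matrix (Fin n) (Fin n) ℝ}
    (hA : ∀ d : Fin n → ℝ, (∀ i, d i ∈ Set.Icc (0 : ℝ) 1) →
      (1 - Matrix.diagonal d + Matrix.diagonal d * A).det ≠ 0) : IsPMatrix A := by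
  intro J _
  let e : Fin n → ℝ := fun i => if i ∈ J then 1 else 0
  let f : ℝ → ℝ := fun t =>
    (1 - Matrix.diagonal (t • e) + Matrix.diagonal (t • e) * A).det
  have hf : Continuous f := by
    have h : Continuous fun t : ℝ => Matrix.diagonal (t • e) :=
      Continuous.matrix_diagonal (by fun_prop)
    exact ((continuous_const.sub h).add (h.matrix_mul continuous_const)).matrix_det
  have hf0 : f 0 = 1 := by simp [f]
  have hf1 : f 1 = (A.submatrix (fun j : J => (j : Fin n)) (fun j : J => (j : Fin n))).det := by
    rw [← det_piecewise_one]
    simp only [f, one_smul]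
    congr 1
    ext i j
    by_cases hi : i ∈ J
    · rcases eq_or_ne i j with rfl | hij
      · simp [e, hi, Matrix.row, Finset.piecewise]
      · simp [e, hi, Matrix.row, Finset.piecewise, hij]
    · rcases eq_or_ne i j with rfl | hij
      · simp [e, hi, Matrix.row, Finset.piecewise]
      · simp [e, hi, Matrix.row, Finset.piecewise, hij]
  rw [← hf1]
  by_contra! hneg
  obtain ⟨t, ht, hft⟩ := intermediate_value_Icc' zero_le_one hf.continuousOn
    (show (0 : ℝ) ∈ Set.Icc (f 1) (f 0) from ⟨hneg, by rw [hf0]; exact zero_le_one⟩)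
  refine hA (t • e) (fun i => ?_) hft
  by_cases hi : i ∈ J
  · simpa [e, hi] using ht
  · simp [e, hi]

/-- For a P-matrix the supremum defining `betaP` bounds every member of the family. -/
theorem IsPMatrix.norm_le_betaP_s11 {n : ℕ} {A : Matrix (Fin n) (Fin n) ℝ} (hA : IsPMatrix A)
    {d : Fin n → ℝ} (hd : ∀ i, d i ∈ Set.Icc (0 : ℝ) 1) :
    ‖Matrix.toEuclideanCLM (𝕜 := ℝ)
      ((1 - Matrix.diagonal d + Matrix.diagonal d * A)⁻¹ * Matrix.diagonal d)‖ ≤ betaP A := by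
  refine le_csSup (IsCompact.bddAbove ?_) (Set.mem_image_of_mem _ hd)
  refine IsCompact.image_of_continuousOn ?_ ?_
  · have h : {d : Fin n → ℝ | ∀ i, d i ∈ Set.Icc (0 : ℝ) 1} =
        Set.univ.pi fun _ => Set.Icc (0 : ℝ) 1 := by
      ext; simp only [Set.mem_ofPred_eq, Set.mem_univ_pi]
    rw [h]
    exact isCompact_univ_pi fun _ => isCompact_Icc
  · have hdiag : Continuous fun d : Fin n → ℝ => Matrix.diagonal d :=
      Continuous.matrix_diagonal continuous_id
    have hF : Continuous fun d : Fin n → ℝ =>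
        1 - Matrix.diagonal d + Matrix.diagonal d * A :=
      (continuous_const.sub hdiag).add (hdiag.matrix_mul continuous_const)
    have hL : Continuous (Matrix.toEuclideanCLM (n := Fin n) (𝕜 := ℝ)) :=
      (Matrix.toEuclideanCLM (n := Fin n) (𝕜 := ℝ)).toAlgEquiv.toLinearMap.continuous_of_finiteDimensional
    refine (hL.comp_continuousOn ?_).norm
    have hinv : ContinuousOn (fun d : Fin n → ℝ =>
        (1 - Matrix.diagonal d + Matrix.diagonal d * A)⁻¹)
        {d : Fin n → ℝ | ∀ i, d i ∈ Set.Icc (0 : ℝ) 1} := by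
      simp only [Matrix.inv_def, Ring.inverse_eq_inv']
      exact (hF.matrix_det.continuousOn.inv₀ fun d hd => (hA.det_pos_s11 hd).ne').smul
        hF.matrix_adjugate.continuousOn
    exact continuousOn_iff_continuous_domRestrict.2
      ((continuousOn_iff_continuous_domRestrict.1 hinv).matrix_mul
        (hdiag.comp continuous_subtype_val))

/-- If `M` is a P-matrix and `β(M)·‖ΔM‖ ≤ η < 1`, then `M + ΔM` is a P-matrix and
`β(M + ΔM) ≤ β(M) / (1 − η)`. -/
theorem stmt_11 {n : ℕ} (M ΔM : Matrix (Fin n) (Fin n) ℝ) (η : ℝ)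
    (hM : IsPMatrix M)
    (hη : betaP M * ‖Matrix.toEuclideanCLM (𝕜 := ℝ) ΔM‖ ≤ η) (hη1 : η < 1) :
    IsPMatrix (M + ΔM) ∧ betaP (M + ΔM) ≤ betaP M / (1 - η) := by
  let L := Matrix.toEuclideanCLM (n := Fin n) (𝕜 := ℝ)
  have hbound : ∀ d : Fin n → ℝ, (∀ i, d i ∈ Set.Icc (0 : ℝ) 1) →
      (1 - Matrix.diagonal d + Matrix.diagonal d * (M + ΔM)).det ≠ 0 ∧
      ‖L ((1 - Matrix.diagonal d + Matrix.diagonal d * (M + ΔM))⁻¹ * Matrix.diagonal d)‖ ≤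
        betaP M / (1 - η) := by
    intro d hd
    have hG := hM.norm_le_betaP_s11 hd
    have hFunit := (hM.det_pos_s11 hd).ne'.isUnit
    set D := Matrix.diagonal d
    set F := 1 - D + D * M with hF
    set G := F⁻¹ * D
    have hFG : F * G = D := Matrix.mul_nonsing_inv_cancel_left _ _ hFunit
    have hGΔ : ‖L G * L ΔM‖ ≤ η :=
      (norm_mul_le _ _).trans ((mul_le_mul_of_nonneg_right hG (norm_nonneg _)).trans hη)
    have hF' : 1 - D + D * (M + ΔM) = F * (1 + G * ΔM) := by
      rw [mul_add, mul_add, mul_one, ← mul_assoc F, hFG, hF, add_assoc]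
    have hE : IsUnit (1 + G * ΔM) := by
      have h : IsUnit (L (1 + G * ΔM)) := by
        have := isUnit_one_sub_of_norm_lt_one (x := -(L G * L ΔM))
          (by rw [norm_neg]; exact hGΔ.trans_lt hη1)
        simpa [sub_neg_eq_add] using this
      exact (MulEquiv.isUnit_map L).1 h
    have hF'unit : IsUnit (1 - D + D * (M + ΔM)).det := by
      rw [hF', Matrix.det_mul]
      exact hFunit.mul ((Matrix.isUnit_iff_isUnit_det _).1 hE)
    refine ⟨hF'unit.ne_zero, ?_⟩
    let X := (1 - D + D * (M + ΔM))⁻¹ * D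
    have hX : (1 + G * ΔM) * X = G := by
      have h : F * ((1 + G * ΔM) * X) = D := by
        rw [← mul_assoc, ← hF']
        exact Matrix.mul_nonsing_inv_cancel_left _ _ hF'unit
      calc (1 + G * ΔM) * X = F⁻¹ * (F * ((1 + G * ΔM) * X)) :=
            (Matrix.nonsing_inv_mul_cancel_left _ _ hFunit).symm
        _ = G := by rw [h]
    have hLX : L X = L G - L G * L ΔM * L X := by
      rw [← map_mul, ← map_mul, ← map_sub]
      congr 1
      rw [eq_sub_iff_add_eq]
      rw [add_mul, one_mul] at hX
      exact hX
    have hnorm : ‖L X‖ ≤ betaP M + η * ‖L X‖ := by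
      calc ‖L X‖ = ‖L G - L G * L ΔM * L X‖ := by rw [← hLX]
        _ ≤ ‖L G‖ + ‖L G * L ΔM * L X‖ := norm_sub_le _ _
        _ ≤ betaP M + η * ‖L X‖ := add_le_add hG ((norm_mul_le _ _).trans
            (mul_le_mul_of_nonneg_right hGΔ (norm_nonneg _)))
    rw [le_div_iff₀ (by linarith)]
    linarith
  refine ⟨isPMatrix_of_det_ne_zero fun d hd => (hbound d hd).1, csSup_le ?_ ?_⟩
  · exact ⟨_, Set.mem_image_of_mem _
      (show (0 : Fin n → ℝ) ∈ _ from fun i => ⟨le_rfl, zero_le_one⟩)⟩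
  · rintro _ ⟨d, hd, rfl⟩
    exact (hbound d hd).2
end
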